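/- Let G be a connected simple complex Lie group, P ⊆ G a parabolic subgroup corresponding to simple roots Δ \ Δ_P = {α_{j₁}, …, α_{j_r}}, and W^P the set of minimal length coset representatives of W/W_P. For u, w ∈ W^P, let u_i, w_i ∈ W^{P_{j_i}} be the minimal length representatives of uW_{P_{j_i}}, wW_{P_{j_i}}. Then u ≤ w in Bruhat order if and only if u_i ≤ w_i for all 1 ≤ i ≤ r. -/

import Mathlib

open CoxeterSystem

variable {B W : Type*} [Group W]

/-- Bruhat order on a Coxeter group: `u ≤ w` iff some reduced word for `w` has a
reduced subword expressing `u`. -/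
def BruhatLE {M : CoxeterMatrix B} (cs : CoxeterSystem M W) (u w : W) : Prop :=
  ∃ ω : List B, cs.IsReduced ω ∧ cs.wordProd ω = w ∧
    ∃ ω' : List B, ω'.Sublist ω ∧ cs.IsReduced ω' ∧ cs.wordProd ω' = u

/-- The standard parabolic subgroup `W_S` generated by the simple reflections `s_i`,
`i ∈ S`. -/
def parabolicSubgroup {M : CoxeterMatrix B} (cs : CoxeterSystem M W) (S : Set B) :
    Subgroup W :=
  Subgroup.closure (cs.simple '' S)

/-- `u` is the minimal length representative of its coset `u W_S`, i.e. `u ∈ W^S`: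
equivalently `ℓ(u s_i) > ℓ(u)` for all `i ∈ S`. -/
def IsMinRep {M : CoxeterMatrix B} (cs : CoxeterSystem M W) (S : Set B) (u : W) : Prop :=
  ∀ i ∈ S, cs.length u < cs.length (u * cs.simple i)

/-! ### The strong exchange property -/

namespace CoxeterSystem

open List

variable {M : CoxeterMatrix B} (cs : CoxeterSystem M W)

open Classical in
/-- The involution `(t, z) ↦ (s_i t s_i, z + [t = s_i])` of `W × ℤ/2`. -/
noncomputable def signedConj (i : B) : Equiv.Perm (W × ZMod 2) :=
  Function.Involutive.toPerm
    (fun p ↦ (cs.simple i * p.1 * cs.simple i, p.2 + if p.1 = cs.simple i then 1 else 0)) (by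
      rintro ⟨t, z⟩
      have h : cs.simple i * t * cs.simple i = cs.simple i ↔ t = cs.simple i := by
        rw [mul_eq_right, ← cs.inv_simple i, inv_mul_eq_one, cs.inv_simple, eq_comm]
      ext
      · simp [mul_assoc]
      · simp only [h, add_assoc, CharTwo.add_self_eq_zero, add_zero])

open Classical in
theorem signedConj_apply (i : B) (t : W) (z : ZMod 2) :
    cs.signedConj i (t, z) =
      (cs.simple i * t * cs.simple i, z + if t = cs.simple i then 1 else 0) := rfl

open Classical in
theorem signedConj_mul_pow_apply (i j : B) (n : ℕ) (t : W) (z : ZMod 2) :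
    ((cs.signedConj i * cs.signedConj j) ^ n) (t, z) =
      ((cs.simple i * cs.simple j) ^ n * t * ((cs.simple i * cs.simple j) ^ n)⁻¹,
        z + ∑ m ∈ Finset.range (2 * n),
          if t = (cs.simple j * cs.simple i) ^ m * cs.simple j then 1 else 0) := by
  induction n with
  | zero => simp
  | succ n ih =>
    have hr : (cs.simple i * cs.simple j)⁻¹ = cs.simple j * cs.simple i := by simp
    have key (a : W) (k : ℕ) : (cs.simple i * cs.simple j) ^ k * t *
        ((cs.simple i * cs.simple j) ^ k)⁻¹ = a ↔
        t = (cs.simple j * cs.simple i) ^ k * a * (cs.simple i * cs.simple j) ^ k := by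
      rw [← hr, inv_pow, mul_inv_eq_iff_eq_mul, mul_assoc, eq_inv_mul_iff_mul_eq]
    have hc (k : ℕ) : cs.simple j * (cs.simple i * cs.simple j) ^ k =
        (cs.simple j * cs.simple i) ^ k * cs.simple j := by
      have : SemiconjBy (cs.simple j) (cs.simple i * cs.simple j) (cs.simple j * cs.simple i) := by
        simp [SemiconjBy, mul_assoc]
      exact (this.pow_right k)
    rw [pow_succ', Equiv.Perm.mul_apply, ih, Equiv.Perm.mul_apply, signedConj_apply,
      signedConj_apply, Nat.mul_succ, Finset.sum_range_succ, Finset.sum_range_succ]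
    congr 1
    · rw [pow_succ', mul_inv_rev (cs.simple i * cs.simple j), hr]
      simp only [mul_assoc]
    · have h1 : (cs.simple i * cs.simple j) ^ n * t * ((cs.simple i * cs.simple j) ^ n)⁻¹ =
          cs.simple j ↔ t = (cs.simple j * cs.simple i) ^ (2 * n) * cs.simple j := by
        rw [key, mul_assoc, hc, ← mul_assoc, ← pow_add, two_mul]
      have h2 : cs.simple j * ((cs.simple i * cs.simple j) ^ n * t *
          ((cs.simple i * cs.simple j) ^ n)⁻¹) * cs.simple j = cs.simple i ↔
          t = (cs.simple j * cs.simple i) ^ (2 * n + 1) * cs.simple j := by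
        rw [← eq_mul_inv_iff_mul_eq, ← eq_inv_mul_iff_mul_eq, key, cs.inv_simple, mul_assoc,
          mul_assoc, mul_assoc, hc, ← mul_assoc (cs.simple i), ← mul_assoc (cs.simple j),
          ← mul_assoc (cs.simple j), ← pow_succ', ← mul_assoc, ← pow_add,
          show n + (n + 1) = 2 * n + 1 by ring]
      simp only [h1, h2]
      ring

theorem isLiftable_signedConj : M.IsLiftable cs.signedConj := by
  classical
  intro i j
  ext1 ⟨t, z⟩
  have h := cs.simple_mul_simple_pow' i j
  rw [signedConj_mul_pow_apply, cs.simple_mul_simple_pow, two_mul, Finset.sum_range_add]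
  simp [pow_add, h, CharTwo.add_self_eq_zero]

/-- The action of `W` on `W × ℤ/2` extending `signedConj`. -/
noncomputable def signedConjHom : W →* Equiv.Perm (W × ZMod 2) :=
  cs.lift ⟨cs.signedConj, cs.isLiftable_signedConj⟩

theorem signedConjHom_simple (i : B) : cs.signedConjHom (cs.simple i) = cs.signedConj i :=
  cs.lift_apply_simple _ i

open Classical in
theorem signedConjHom_wordProd (ω : List B) (t : W) (z : ZMod 2) :
    cs.signedConjHom (cs.wordProd ω) (t, z) =
      (cs.wordProd ω * t * (cs.wordProd ω)⁻¹, z + (cs.rightInvSeq ω).count t) := by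
  induction ω with
  | nil => simp
  | cons i ω ih =>
    have h : cs.wordProd ω * t * (cs.wordProd ω)⁻¹ = cs.simple i ↔
        (cs.wordProd ω)⁻¹ * cs.simple i * cs.wordProd ω = t := by
      rw [mul_inv_eq_iff_eq_mul, eq_comm, mul_assoc, inv_mul_eq_iff_eq_mul]
    rw [cs.wordProd_cons, map_mul, Equiv.Perm.mul_apply, ih, signedConjHom_simple, signedConj_apply]
    simp only [h, rightInvSeq, List.count_cons, beq_iff_eq]
    ext
    · simp [mul_assoc]
    · push_cast
      simp only [add_assoc]

theorem signedConjHom_add (w t : W) (z c : ZMod 2) :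
    cs.signedConjHom w (t, z + c) =
      ((cs.signedConjHom w (t, z)).1, (cs.signedConjHom w (t, z)).2 + c) := by
  classical
  obtain ⟨ω, rfl⟩ := cs.wordProd_surjective w
  simp only [signedConjHom_wordProd, add_right_comm]

theorem signedConjHom_self {t : W} (ht : cs.IsReflection t) (z : ZMod 2) :
    cs.signedConjHom t (t, z) = (t, z + 1) := by
  obtain ⟨v, i, rfl⟩ := ht
  obtain ⟨y, hy⟩ : ∃ y, cs.signedConjHom v⁻¹ (v * cs.simple i * v⁻¹, z) = (cs.simple i, y) := by
    classical
    obtain ⟨ω, hω⟩ := cs.wordProd_surjective v⁻¹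
    rw [← hω, signedConjHom_wordProd, hω]
    simp [mul_assoc]
  have hy' : cs.signedConjHom v (cs.simple i, y) = (v * cs.simple i * v⁻¹, z) := by
    rw [← hy, ← Equiv.Perm.mul_apply, ← map_mul]
    simp
  rw [map_mul, map_mul, Equiv.Perm.mul_apply, Equiv.Perm.mul_apply, hy, signedConjHom_simple,
    signedConj_apply, if_pos rfl, cs.simple_mul_simple_self, one_mul, signedConjHom_add, hy']

/-- A right inversion of `π ω` occurs in the right inversion sequence of `ω`, whether or not `ω`
is reduced. -/
theorem IsRightInversion.mem_rightInvSeq {ω : List B} {t : W}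
    (h : cs.IsRightInversion (cs.wordProd ω) t) : t ∈ cs.rightInvSeq ω := by
  classical
  obtain ⟨ht, hlt⟩ := h
  by_contra hmem
  obtain ⟨ω', hω', hp⟩ := cs.exists_isReduced (cs.wordProd ω * t)
  have h1 : cs.signedConjHom (cs.wordProd ω * t) (t, 0) =
      (cs.wordProd ω * t * (cs.wordProd ω)⁻¹, 1) := by
    rw [map_mul, Equiv.Perm.mul_apply, cs.signedConjHom_self ht, signedConjHom_wordProd,
      List.count_eq_zero_of_not_mem hmem]
    simp
  rw [hp, signedConjHom_wordProd] at h1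
  have hmem' : t ∈ cs.rightInvSeq ω' := by
    by_contra hn
    rw [List.count_eq_zero_of_not_mem hn] at h1
    simpa using congrArg Prod.snd h1
  have h2 := (cs.isRightInversion_of_mem_rightInvSeq hω' hmem').2
  rw [← hp, mul_assoc, ht.mul_self, mul_one] at h2
  lia

theorem exists_wordProd_eraseIdx_of_length_lt {u : W} {ω : List B}
    (ht : cs.IsReflection (cs.wordProd ω * u⁻¹)) (hlt : cs.length u < cs.length (cs.wordProd ω)) :
    ∃ j < ω.length, cs.wordProd (ω.eraseIdx j) = u := by
  set w := cs.wordProd ω with hw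
  have hu : w * (u⁻¹ * w) = u := by
    have := ht.mul_self
    rw [← eq_inv_iff_mul_eq_one] at this
    rw [← mul_assoc, this]
    simp
  have ht' : cs.IsReflection (u⁻¹ * w) := by
    simpa [mul_assoc] using ht.conj u⁻¹
  have hmem := IsRightInversion.mem_rightInvSeq cs (ω := ω) (t := u⁻¹ * w)
    ⟨ht', by rwa [← hw, hu]⟩
  obtain ⟨j, hj, hje⟩ := List.mem_iff_getElem.mp hmem
  refine ⟨j, by simpa using hj, ?_⟩
  rw [← wordProd_mul_getD_rightInvSeq, List.getD_eq_getElem _ 1 hj, hje, ← hw, hu]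

theorem exists_isReduced_sublist (ω : List B) :
    ∃ ω', ω' <+ ω ∧ cs.IsReduced ω' ∧ cs.wordProd ω' = cs.wordProd ω := by
  induction ω with
  | nil => exact ⟨[], .refl _, by simp [IsReduced], rfl⟩
  | cons i ω ih =>
    obtain ⟨ω', hsub, hred, hp⟩ := ih
    rw [cs.wordProd_cons, ← hp]
    rcases cs.length_simple_mul (cs.wordProd ω') i with h | h
    · refine ⟨i :: ω', hsub.cons_cons i, ?_, cs.wordProd_cons i ω'⟩
      rw [IsReduced, cs.wordProd_cons, h, hred.eq, List.length_cons]
    · have ht : cs.IsReflection (cs.wordProd ω' * (cs.simple i * cs.wordProd ω')⁻¹) := by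
        simpa using cs.isReflection_simple i
      obtain ⟨j, hj, hje⟩ := cs.exists_wordProd_eraseIdx_of_length_lt ht (by lia)
      refine ⟨ω'.eraseIdx j, ((List.eraseIdx_sublist ω' j).trans hsub).cons i, ?_, hje⟩
      have := List.length_eraseIdx_add_one hj
      rw [IsReduced, hje]
      have := hred.eq
      lia

end CoxeterSystem

/-! ### The geometric representation -/

namespace CoxeterMatrix

open Polynomial.Chebyshev

variable (M : CoxeterMatrix B)

/-- The `i`-th simple coroot `α_j ↦ -2 cos(π / M i j)` on the space with basis the simple roots. -/
noncomputable def simpleCoroot (i : B) : Module.Dual ℝ (B →₀ ℝ) :=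
  Finsupp.linearCombination ℝ fun j ↦ -2 * Real.cos (Real.pi / M i j)

theorem simpleCoroot_single (i j : B) :
    M.simpleCoroot i (Finsupp.single j 1) = -2 * Real.cos (Real.pi / M i j) := by
  simp [simpleCoroot]

theorem simpleCoroot_single_self (i : B) : M.simpleCoroot i (Finsupp.single i 1) = 2 := by
  simp [simpleCoroot_single]

/-- The `i`-th simple reflection in the geometric representation. -/
noncomputable def simpleReflection (i : B) : (B →₀ ℝ) ≃ₗ[ℝ] (B →₀ ℝ) :=
  Module.reflection (M.simpleCoroot_single_self i)

theorem simpleReflection_apply (i : B) (v : B →₀ ℝ) :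
    M.simpleReflection i v = v - M.simpleCoroot i v • Finsupp.single i 1 :=
  Module.reflection_apply _ _

theorem isLiftable_simpleReflection : M.IsLiftable M.simpleReflection := by
  intro i j
  rcases eq_or_ne i j with rfl | hij
  · ext1 v
    simpa [simpleReflection] using Module.involutive_reflection _ v
  have h1 : M i j ≠ 1 := M.off_diagonal i j hij
  ext1 v
  rcases Nat.lt_or_ge 2 (M i j) with hm | hm
  · set m := M i j with hmdef
    set φ : ℝ := 2 * (Real.pi / m) with hφ
    have hm0 : (0 : ℝ) < m := by positivity
    have hmφ : m * φ = 2 * Real.pi := by rw [hφ]; field_simp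
    have hsin : Real.sin φ ≠ 0 := by
      have : (2 : ℝ) < m := by exact_mod_cast hm
      refine (Real.sin_pos_of_pos_of_lt_pi (by positivity) ?_).ne'
      rw [hφ, ← mul_div_assoc, div_lt_iff₀ hm0]
      nlinarith [Real.pi_pos]
    have ht : 2 * Real.cos φ =
        M.simpleCoroot i (Finsupp.single j 1) * M.simpleCoroot j (Finsupp.single i 1) - 2 := by
      rw [simpleCoroot_single, simpleCoroot_single, M.symmetric j i, ← hmdef, hφ, Real.cos_two_mul]
      ring
    have hS (n : ℤ) : (S ℝ n).eval (2 * Real.cos φ) = Real.sin ((n + 1) * φ) / Real.sin φ := by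
      rw [eq_div_iff hsin, S_two_mul_real_cos]
    have hpow := Module.reflection_mul_reflection_pow_apply (M.simpleCoroot_single_self i)
      (M.simpleCoroot_single_self j) m v _ ht
    simp only [simpleReflection]
    rw [hpow]
    rcases Nat.even_or_odd' m with ⟨k, hk | hk⟩
    · have e1 : ((m : ℤ) - 1) / 2 = k - 1 := by lia
      have e2 : ((m : ℤ) - 2) / 2 = k - 1 := by lia
      have hz : (S ℝ (k - 1 : ℤ)).eval (2 * Real.cos φ) = 0 := by
        have : (k : ℝ) * φ = Real.pi := by
          rw [hk] at hmφ
          push_cast at hmφ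
          linarith
        rw [hS]
        simp [this]
      simp [e1, e2, hz]
    · have e1 : ((m : ℤ) - 1) / 2 = k := by lia
      have e2 : ((m : ℤ) - 2) / 2 = k - 1 := by lia
      have e3 : ((m : ℤ) - 3) / 2 = k - 1 := by lia
      have e4 : (m : ℤ) / 2 = k := by lia
      have hz : (S ℝ (k : ℤ)).eval (2 * Real.cos φ) + (S ℝ (k - 1 : ℤ)).eval (2 * Real.cos φ)
          = 0 := by
        have : ((k : ℝ) + 1) * φ = 2 * Real.pi - k * φ := by
          rw [hk] at hmφ
          push_cast at hmφ
          linarith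
        rw [hS, hS]
        push_cast
        rw [this, Real.sin_two_pi_sub]
        ring_nf
      simp [e1, e2, e3, e4, hz]
  · rcases (show M i j = 0 ∨ M i j = 2 by lia) with h | h
    · simp [h]
    · have h' : M j i = 2 := by rw [M.symmetric, h]
      simp only [h, pow_two, LinearEquiv.mul_apply, simpleReflection_apply, map_sub, map_smul,
        simpleCoroot_single_self]
      simp only [simpleCoroot_single, h, h', Nat.cast_ofNat, Real.cos_pi_div_two,
        LinearEquiv.coe_one, id_eq]
      module

end CoxeterMatrix

namespace CoxeterSystem

variable {M : CoxeterMatrix B} (cs : CoxeterSystem M W)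

/-- The geometric representation of a Coxeter group. -/
noncomputable def geometricRep : W →* ((B →₀ ℝ) ≃ₗ[ℝ] (B →₀ ℝ)) :=
  cs.lift ⟨M.simpleReflection, M.isLiftable_simpleReflection⟩

theorem geometricRep_simple (i : B) : cs.geometricRep (cs.simple i) = M.simpleReflection i :=
  cs.lift_apply_simple _ i

theorem simple_notMem_closure {i : B} {J : Set B} (hi : i ∉ J) :
    cs.simple i ∉ Subgroup.closure (cs.simple '' J) := by
  intro h
  have key : ∀ g ∈ Subgroup.closure (cs.simple '' J), ∀ v, cs.geometricRep g v i = v i := by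
    intro g hg
    induction hg using Subgroup.closure_induction with
    | mem x hx =>
      obtain ⟨j, hj, rfl⟩ := hx
      have hji : j ≠ i := by rintro rfl; exact hi hj
      intro v
      simp [geometricRep_simple, M.simpleReflection_apply, hji]
    | one => simp
    | mul x y _ _ hx hy => simp [hx, hy]
    | inv x _ hx =>
      intro v
      rw [← hx (cs.geometricRep x⁻¹ v), ← LinearEquiv.mul_apply, ← map_mul]
      simp
  have := key _ h (Finsupp.single i 1)
  rw [geometricRep_simple, M.simpleReflection_apply, M.simpleCoroot_single_self] at this
  norm_num at this

end CoxeterSystem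

/-! ### The Bruhat order -/

namespace CoxeterSystem

open List Relation

variable {M : CoxeterMatrix B} (cs : CoxeterSystem M W)

/-- `BruhatStep u v` says that `v` is longer than `u` and `v = t u` for a reflection `t`. -/
def BruhatStep (u v : W) : Prop := cs.IsReflection (v * u⁻¹) ∧ cs.length u < cs.length v

variable {cs}

theorem BruhatStep.of_lt_simple_mul {i : B} {u : W}
    (h : cs.length u < cs.length (cs.simple i * u)) : cs.BruhatStep u (cs.simple i * u) :=
  ⟨by simpa using cs.isReflection_simple i, h⟩

theorem BruhatStep.of_simple_mul_lt {i : B} {u : W}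
    (h : cs.length (cs.simple i * u) < cs.length u) : cs.BruhatStep (cs.simple i * u) u :=
  ⟨by simpa using cs.isReflection_simple i, h⟩

theorem BruhatStep.simple_mul {u v : W} (h : cs.BruhatStep u v) (i : B) :
    cs.BruhatStep (cs.simple i * u) (cs.simple i * v) ∨ cs.simple i * u = v := by
  obtain ⟨ht, hlt⟩ := h
  have hconj : cs.IsReflection (cs.simple i * v * (cs.simple i * u)⁻¹) := by
    simpa [mul_assoc] using ht.conj (cs.simple i)
  by_cases hc : cs.length (cs.simple i * u) < cs.length (cs.simple i * v)
  · exact .inl ⟨hconj, hc⟩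
  right
  have hne : cs.length (cs.simple i * u) ≠ cs.length (cs.simple i * v) := by
    have := hconj.length_mul_right_ne (cs.simple i * u)
    rw [inv_mul_cancel_right] at this
    exact this.symm
  have h1 := cs.length_simple_mul u i
  have h2 := cs.length_simple_mul v i
  obtain ⟨β, hβ, hβp⟩ := cs.exists_isReduced (cs.simple i * v)
  have hv : cs.wordProd (i :: β) = v := by simp [cs.wordProd_cons, ← hβp]
  obtain ⟨j, hj, hje⟩ := cs.exists_wordProd_eraseIdx_of_length_lt (ω := i :: β) (u := u)
    (by rwa [hv]) (by rwa [hv])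
  cases j with
  | zero =>
    rw [List.eraseIdx_cons_zero, ← hβp] at hje
    simp [← hje]
  | succ j =>
    rw [List.eraseIdx_cons_succ, cs.wordProd_cons] at hje
    have h3 : cs.length (cs.simple i * u) ≤ (β.eraseIdx j).length := by
      rw [← hje, cs.simple_mul_simple_cancel_left]
      exact cs.length_wordProd_le _
    have h4 := List.length_eraseIdx_add_one (l := β) (i := j) (by simpa using hj)
    have h5 := hβ.eq
    rw [← hβp] at h5
    lia

theorem BruhatStep.reflTransGen_simple_mul {u v : W} (h : ReflTransGen cs.BruhatStep u v) (i : B) :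
    ReflTransGen cs.BruhatStep (cs.simple i * u) v ∨
      ReflTransGen cs.BruhatStep (cs.simple i * u) (cs.simple i * v) := by
  induction h using ReflTransGen.head_induction_on with
  | refl => exact .inr .refl
  | head hab hbv ih =>
    rcases hab.simple_mul i with h | h
    · exact ih.imp (.head h) (.head h)
    · exact .inl (h ▸ hbv)

theorem BruhatStep.exists_sublist {u v : W} (h : ReflTransGen cs.BruhatStep u v) {ω : List B}
    (hω : cs.wordProd ω = v) : ∃ ω', ω' <+ ω ∧ cs.wordProd ω' = u := by
  induction h generalizing ω with
  | refl => exact ⟨ω, .refl ω, hω⟩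
  | tail _ hbc ih =>
    subst hω
    obtain ⟨j, _, hje⟩ := cs.exists_wordProd_eraseIdx_of_length_lt hbc.1 hbc.2
    obtain ⟨ω', hsub, hp⟩ := ih hje
    exact ⟨ω', hsub.trans (List.eraseIdx_sublist ω j), hp⟩

theorem BruhatStep.reflTransGen_of_sublist {ω ω' : List B} (hsub : ω' <+ ω)
    (hω : cs.IsReduced ω) :
    ReflTransGen cs.BruhatStep (cs.wordProd ω') (cs.wordProd ω) := by
  induction hsub with
  | slnil => exact .refl
  | @cons l₁ l₂ i hsub ih =>
    have hred : cs.IsReduced l₂ := by simpa using hω.drop 1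
    have hlt : cs.length (cs.wordProd l₂) < cs.length (cs.simple i * cs.wordProd l₂) := by
      rw [← cs.wordProd_cons, hω.eq, hred.eq]
      simp
    rw [cs.wordProd_cons]
    exact (ih hred).tail (.of_lt_simple_mul hlt)
  | @cons_cons l₁ l₂ i hsub ih =>
    have hred : cs.IsReduced l₂ := by simpa using hω.drop 1
    have hlt : cs.length (cs.wordProd l₂) < cs.length (cs.simple i * cs.wordProd l₂) := by
      rw [← cs.wordProd_cons, hω.eq, hred.eq]
      simp
    rw [cs.wordProd_cons, cs.wordProd_cons]
    rcases BruhatStep.reflTransGen_simple_mul (ih hred) i with h | h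
    · exact h.tail (.of_lt_simple_mul hlt)
    · exact h

end CoxeterSystem

namespace BruhatLE

open CoxeterSystem List Relation

variable {M : CoxeterMatrix B} {cs : CoxeterSystem M W} {u v w : W}

theorem of_reflTransGen (h : ReflTransGen cs.BruhatStep u w) : BruhatLE cs u w := by
  obtain ⟨ω, hω, rfl⟩ := cs.exists_isReduced w
  obtain ⟨ω', hsub, rfl⟩ := BruhatStep.exists_sublist h rfl
  obtain ⟨ω'', hsub', hred, hp⟩ := cs.exists_isReduced_sublist ω'
  exact ⟨ω, hω, rfl, ω'', hsub'.trans hsub, hred, hp⟩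

theorem reflTransGen (h : BruhatLE cs u w) : ReflTransGen cs.BruhatStep u w := by
  obtain ⟨ω, hω, rfl, ω', hsub, -, rfl⟩ := h
  exact BruhatStep.reflTransGen_of_sublist hsub hω

theorem refl (cs : CoxeterSystem M W) (u : W) : BruhatLE cs u u := of_reflTransGen .refl

theorem trans (h₁ : BruhatLE cs u v) (h₂ : BruhatLE cs v w) : BruhatLE cs u w :=
  of_reflTransGen (h₁.reflTransGen.trans h₂.reflTransGen)

theorem length_le (h : BruhatLE cs u w) : cs.length u ≤ cs.length w := by
  obtain ⟨ω, hω, rfl, ω', hsub, hω', rfl⟩ := h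
  rw [hω.eq, hω'.eq]
  exact hsub.length_le

theorem eq_one (h : BruhatLE cs u 1) : u = 1 := by
  have := h.length_le
  rw [cs.length_one] at this
  exact cs.length_eq_zero_iff.mp (by lia)

theorem inv (h : BruhatLE cs u w) : BruhatLE cs u⁻¹ w⁻¹ := by
  obtain ⟨ω, hω, rfl, ω', hsub, hω', rfl⟩ := h
  exact ⟨ω.reverse, hω.reverse, cs.wordProd_reverse ω, ω'.reverse, hsub.reverse, hω'.reverse,
    cs.wordProd_reverse ω'⟩

theorem of_lt_simple_mul {i : B} (h : cs.length u < cs.length (cs.simple i * u)) :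
    BruhatLE cs u (cs.simple i * u) :=
  of_reflTransGen (.single (.of_lt_simple_mul h))

theorem of_simple_mul_lt {i : B} (h : cs.length (cs.simple i * u) < cs.length u) :
    BruhatLE cs (cs.simple i * u) u :=
  of_reflTransGen (.single (.of_simple_mul_lt h))

theorem le_or_simple_mul_le (h : BruhatLE cs u w) (i : B) :
    BruhatLE cs u (cs.simple i * w) ∨ BruhatLE cs (cs.simple i * u) (cs.simple i * w) := by
  obtain ⟨β, hβ, hβp⟩ := cs.exists_isReduced (cs.simple i * w)
  obtain ⟨ω', hsub, hp⟩ := BruhatStep.exists_sublist h.reflTransGen (ω := i :: β)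
    (by simp [cs.wordProd_cons, ← hβp])
  rw [hβp]
  cases hsub with
  | cons _ hsub =>
    exact .inl (of_reflTransGen (hp ▸ BruhatStep.reflTransGen_of_sublist hsub hβ))
  | @cons_cons l₁ _ _ hsub =>
    have : cs.simple i * u = cs.wordProd l₁ := by simp [← hp, cs.wordProd_cons]
    exact .inr (of_reflTransGen (this ▸ BruhatStep.reflTransGen_of_sublist hsub hβ))

theorem le_simple_mul {i : B} (h : BruhatLE cs u w)
    (hu : cs.length u < cs.length (cs.simple i * u)) : BruhatLE cs u (cs.simple i * w) :=
  (h.le_or_simple_mul_le i).elim id (of_lt_simple_mul hu).trans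

theorem simple_mul_le_simple_mul {i : B} (h : BruhatLE cs u w)
    (hu : cs.length (cs.simple i * u) < cs.length u) :
    BruhatLE cs (cs.simple i * u) (cs.simple i * w) :=
  (h.le_or_simple_mul_le i).elim (of_simple_mul_lt hu).trans id

theorem of_simple_mul {i : B} (h : BruhatLE cs (cs.simple i * u) (cs.simple i * w))
    (hw : cs.length (cs.simple i * w) < cs.length w) : BruhatLE cs u w := by
  rcases BruhatStep.reflTransGen_simple_mul h.reflTransGen i with h' | h'
  · rw [cs.simple_mul_simple_cancel_left] at h'
    exact (of_reflTransGen h').trans (of_simple_mul_lt hw)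
  · rw [cs.simple_mul_simple_cancel_left, cs.simple_mul_simple_cancel_left] at h'
    exact of_reflTransGen h'

theorem le_mul_simple {i : B} (h : BruhatLE cs u w)
    (hu : cs.length u < cs.length (u * cs.simple i)) : BruhatLE cs u (w * cs.simple i) := by
  have hu' : cs.length u⁻¹ < cs.length (cs.simple i * u⁻¹) := by
    rw [← cs.length_inv (cs.simple i * u⁻¹), cs.length_inv]
    simpa using hu
  simpa using (h.inv.le_simple_mul hu').inv

end BruhatLE

/-! ### Minimal coset representatives -/

namespace IsMinRep

open CoxeterSystem List

variable {M : CoxeterMatrix B} {cs : CoxeterSystem M W} {J : Set B} {x y u w g : W}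

theorem le_mul (hx : IsMinRep cs J x) (h : BruhatLE cs x w) (hg : g ∈ parabolicSubgroup cs J) :
    BruhatLE cs x (w * g) := by
  have hinv : ∀ t ∈ cs.simple '' J, t⁻¹ = t := by
    rintro _ ⟨j, -, rfl⟩
    exact cs.inv_simple j
  induction hg using Subgroup.closure_induction_right with
  | one => simpa using h
  | mul_right a _ t ht ih =>
    obtain ⟨j, hj, rfl⟩ := ht
    rw [← mul_assoc]
    exact ih.le_mul_simple (hx j hj)
  | mul_inv_cancel a _ t ht ih =>
    rw [hinv t ht]
    obtain ⟨j, hj, rfl⟩ := ht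
    rw [← mul_assoc]
    exact ih.le_mul_simple (hx j hj)

theorem length_le_mul (hx : IsMinRep cs J x) (hg : g ∈ parabolicSubgroup cs J) :
    cs.length x ≤ cs.length (x * g) :=
  (hx.le_mul (.refl cs x) hg).length_le

/-- Projections to minimal coset representatives preserve the Bruhat order. -/
theorem le_of_le (hx : IsMinRep cs J x)
    (hxu : x⁻¹ * u ∈ parabolicSubgroup cs J) (hyw : y⁻¹ * w ∈ parabolicSubgroup cs J)
    (h : BruhatLE cs u w) : BruhatLE cs x y := by
  have h1 : BruhatLE cs x u := by simpa using hx.le_mul (.refl cs x) hxu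
  simpa using hx.le_mul (h1.trans h) (inv_mem hyw)

/-- Deodhar's lemma: left multiplication by a simple reflection either keeps a minimal coset
representative minimal or stays in its coset. -/
theorem simple_mul (hx : IsMinRep cs J x) (i : B) :
    IsMinRep cs J (cs.simple i * x) ∨ ∃ j ∈ J, cs.simple i * x = x * cs.simple j := by
  by_contra! hc
  obtain ⟨hc, hne⟩ := hc
  obtain ⟨j, hj, hlt⟩ : ∃ j ∈ J,
      ¬ cs.length (cs.simple i * x) < cs.length (cs.simple i * x * cs.simple j) := by
    simpa [IsMinRep] using hc
  have hstep : cs.BruhatStep x (x * cs.simple j) :=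
    ⟨⟨x, j, rfl⟩, hx j hj⟩
  rcases hstep.simple_mul i with h | h
  · rw [← mul_assoc] at h
    exact hlt h.2
  · exact hne j hj h

theorem simple_mul_of_lt (hx : IsMinRep cs J x) {i : B}
    (hlt : cs.length (cs.simple i * x) < cs.length x) : IsMinRep cs J (cs.simple i * x) := by
  rcases hx.simple_mul i with h | ⟨j, hj, h⟩
  · exact h
  · rw [h] at hlt
    have := hx j hj
    lia

theorem exists_word_of_mem_parabolicSubgroup (hg : g ∈ parabolicSubgroup cs J) :
    ∃ ω : List B, (∀ j ∈ ω, j ∈ J) ∧ cs.wordProd ω = g := by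
  induction hg using Subgroup.closure_induction with
  | mem x hx =>
    obtain ⟨j, hj, rfl⟩ := hx
    exact ⟨[j], by simpa using hj, by simp⟩
  | one => exact ⟨[], by simp, by simp⟩
  | mul a b _ _ ha hb =>
    obtain ⟨ω, hω, rfl⟩ := ha
    obtain ⟨ω', hω', rfl⟩ := hb
    refine ⟨ω ++ ω', fun j hj ↦ ?_, cs.wordProd_append ω ω'⟩
    exact (List.mem_append.mp hj).elim (hω j) (hω' j)
  | inv a _ ha =>
    obtain ⟨ω, hω, rfl⟩ := ha
    exact ⟨ω.reverse, by simpa using hω, by simp⟩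

theorem wordProd_mem_parabolicSubgroup {ω : List B} (hω : ∀ j ∈ ω, j ∈ J) :
    cs.wordProd ω ∈ parabolicSubgroup cs J := by
  refine Subgroup.list_prod_mem _ fun x hx ↦ ?_
  obtain ⟨j, hj, rfl⟩ := List.mem_map.mp hx
  exact Subgroup.subset_closure ⟨j, hω j hj, rfl⟩

/-- If `s x` is minimal and longer than `x`, then `s` lengthens every element of `x W_J`. -/
theorem lt_simple_mul {i : B} (hsx : IsMinRep cs J (cs.simple i * x))
    (hlt : cs.length x < cs.length (cs.simple i * x)) (hxu : x⁻¹ * u ∈ parabolicSubgroup cs J) :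
    cs.length u < cs.length (cs.simple i * u) := by
  by_contra hc
  have hsu : cs.length (cs.simple i * u) < cs.length u :=
    (not_lt.mp hc).lt_of_ne (cs.length_simple_mul_ne u i)
  obtain ⟨γ, hγ, hγp⟩ := exists_word_of_mem_parabolicSubgroup hxu
  obtain ⟨ω, hω, hωp⟩ := cs.exists_isReduced x
  have hu : cs.wordProd (ω ++ γ) = u := by simp [cs.wordProd_append, hγp, ← hωp]
  obtain ⟨j, hj, hje⟩ := cs.exists_wordProd_eraseIdx_of_length_lt (ω := ω ++ γ)
    (u := cs.simple i * u) (by rw [hu]; simpa using cs.isReflection_simple i) (by rwa [hu])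
  rcases lt_or_ge j ω.length with hjω | hjω
  · rw [List.eraseIdx_append_of_lt_length hjω, cs.wordProd_append, hγp, ← mul_assoc,
      mul_left_inj, mul_inv_eq_iff_eq_mul] at hje
    have h1 := cs.length_wordProd_le (ω.eraseIdx j)
    have h2 := List.length_eraseIdx_add_one hjω
    have h3 := hω.eq
    rw [hje] at h1
    rw [← hωp] at h3
    lia
  · rw [List.eraseIdx_append_of_length_le hjω, cs.wordProd_append, ← hωp] at hje
    have hmem : cs.wordProd (γ.eraseIdx (j - ω.length)) ∈ parabolicSubgroup cs J :=
      wordProd_mem_parabolicSubgroup fun k hk ↦ hγ k (List.mem_of_mem_eraseIdx hk)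
    have hmem' : (cs.simple i * x)⁻¹ * x ∈ parabolicSubgroup cs J := by
      have h1 : (cs.simple i * x)⁻¹ * x =
          x⁻¹ * u * (cs.wordProd (γ.eraseIdx (j - ω.length)))⁻¹ := by
        rw [eq_mul_inv_iff_mul_eq, mul_assoc, hje]
        simp [mul_assoc]
      rw [h1]
      exact mul_mem hxu (inv_mem hmem)
    have := hsx.length_le_mul hmem'
    rw [mul_inv_cancel_left] at this
    lia

theorem simple_mul_lt (hx : IsMinRep cs J x) {i : B}
    (hlt : cs.length (cs.simple i * x) < cs.length x) (hxu : x⁻¹ * u ∈ parabolicSubgroup cs J) :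
    cs.length (cs.simple i * u) < cs.length u := by
  have := lt_simple_mul (cs := cs) (J := J) (x := cs.simple i * x) (u := cs.simple i * u)
    (i := i) (by simpa using hx) (by simpa using hlt)
    (by simpa [mul_assoc] using hxu)
  simpa using this

theorem lt_mul_simple_of_mem_parabolicSubgroup {i : B} (hu : u ∈ parabolicSubgroup cs {i}ᶜ) :
    cs.length u < cs.length (u * cs.simple i) := by
  by_contra hc
  have hlt : cs.length (u * cs.simple i) < cs.length u :=
    (not_lt.mp hc).lt_of_ne (cs.length_mul_simple_ne u i)
  obtain ⟨γ, hγ, rfl⟩ := exists_word_of_mem_parabolicSubgroup hu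
  obtain ⟨j, hj, hje⟩ := cs.exists_wordProd_eraseIdx_of_length_lt
    (u := cs.wordProd γ * cs.simple i)
    (by rw [mul_inv_rev, ← mul_assoc, cs.inv_simple]; exact ⟨_, i, rfl⟩) hlt
  have hmem : cs.wordProd (γ.eraseIdx j) ∈ parabolicSubgroup cs {i}ᶜ :=
    wordProd_mem_parabolicSubgroup fun k hk ↦ hγ k (List.mem_of_mem_eraseIdx hk)
  rw [hje] at hmem
  have := mul_mem (inv_mem hu) hmem
  rw [inv_mul_cancel_left] at this
  exact cs.simple_notMem_closure (by simp) this

/-- Multiplication by a left descent `s` of `w` is compatible with comparing projections: if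
`x ≤ y` are the projections of `u` and `w`, then the projections of `min (u, s u)` and `s w` are
comparable as well. -/
theorem exists_projection_le {i : B} (hx : IsMinRep cs J x) (hy : IsMinRep cs J y)
    (hxu : x⁻¹ * u ∈ parabolicSubgroup cs J) (hyw : y⁻¹ * w ∈ parabolicSubgroup cs J)
    (hxy : BruhatLE cs x y) (hw : cs.length (cs.simple i * w) < cs.length w) :
    ∃ y', IsMinRep cs J y' ∧ y'⁻¹ * (cs.simple i * w) ∈ parabolicSubgroup cs J ∧
      (cs.length u < cs.length (cs.simple i * u) → BruhatLE cs x y') ∧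
      (cs.length (cs.simple i * u) < cs.length u → ∃ x', IsMinRep cs J x' ∧
        x'⁻¹ * (cs.simple i * u) ∈ parabolicSubgroup cs J ∧ BruhatLE cs x' y') := by
  have stay {z v : W} {j : B} (hj : j ∈ J) (h : cs.simple i * z = z * cs.simple j)
      (hzv : z⁻¹ * v ∈ parabolicSubgroup cs J) :
      z⁻¹ * (cs.simple i * v) ∈ parabolicSubgroup cs J := by
    have e : z⁻¹ * (cs.simple i * v) = cs.simple j * (z⁻¹ * v) := by
      have : z⁻¹ * cs.simple i = cs.simple j * z⁻¹ := by
        rw [inv_mul_eq_iff_eq_mul, ← mul_assoc, ← h, mul_inv_cancel_right]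
      rw [← mul_assoc, this, mul_assoc]
    rw [e]
    exact mul_mem (Subgroup.subset_closure ⟨j, hj, rfl⟩) hzv
  have hxup : cs.length x < cs.length (cs.simple i * x) →
      cs.length (cs.simple i * u) < cs.length u → x⁻¹ * (cs.simple i * u) ∈
        parabolicSubgroup cs J := by
    intro hlt hsu
    rcases hx.simple_mul i with h | ⟨j, hj, h⟩
    · exact absurd (lt_simple_mul h hlt hxu) hsu.not_gt
    · exact stay hj h hxu
  rcases hy.simple_mul i with hsy | ⟨j, hj, h⟩
  · have hlt : cs.length (cs.simple i * y) < cs.length y := by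
      refine (cs.length_simple_mul_ne y i).lt_of_le (not_lt.mp fun hlt ↦ ?_)
      exact (lt_simple_mul hsy hlt hyw).not_gt hw
    refine ⟨_, hsy, by simpa [mul_assoc] using hyw, fun hu ↦ ?_, fun hu ↦ ?_⟩
    · refine hxy.le_simple_mul ((cs.length_simple_mul_ne x i).symm.lt_of_le (not_lt.mp fun h ↦ ?_))
      exact (hx.simple_mul_lt h hxu).not_gt hu
    · rcases (cs.length_simple_mul_ne x i).lt_or_gt with h | h
      · exact ⟨_, hx.simple_mul_of_lt h, by simpa [mul_assoc] using hxu,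
          hxy.simple_mul_le_simple_mul h⟩
      · exact ⟨x, hx, hxup h hu, hxy.le_simple_mul h⟩
  · refine ⟨y, hy, stay hj h hyw, fun _ ↦ hxy, fun hu ↦ ?_⟩
    rcases (cs.length_simple_mul_ne x i).lt_or_gt with h | h
    · exact ⟨_, hx.simple_mul_of_lt h, by simpa [mul_assoc] using hxu,
        (BruhatLE.of_simple_mul_lt h).trans hxy⟩
    · exact ⟨x, hx, hxup h hu, hxy⟩

theorem le_of_forall_projection_le {S : Set B} (hu : IsMinRep cs S u)
    (h : ∀ i ∉ S, ∃ x y, IsMinRep cs {i}ᶜ x ∧ IsMinRep cs {i}ᶜ y ∧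
      x⁻¹ * u ∈ parabolicSubgroup cs {i}ᶜ ∧ y⁻¹ * w ∈ parabolicSubgroup cs {i}ᶜ ∧
      BruhatLE cs x y) : BruhatLE cs u w := by
  induction hn : cs.length w generalizing u w with
  | zero =>
    obtain rfl := cs.length_eq_zero_iff.mp hn
    suffices u = 1 from this ▸ .refl cs u
    by_contra hne
    obtain ⟨i, hi⟩ := cs.exists_rightDescent_of_ne_one hne
    have hiS : i ∉ S := fun hiS ↦ (hu i hiS).not_gt hi
    obtain ⟨x, y, -, hy, hxu, hyw, hxy⟩ := h i hiS
    have hy1 : BruhatLE cs y 1 := by simpa using hy.le_mul (.refl cs y) hyw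
    obtain rfl := (hxy.trans hy1).eq_one
    exact (lt_mul_simple_of_mem_parabolicSubgroup (by simpa using hxu)).not_gt hi
  | succ n ih =>
    have hw1 : w ≠ 1 := by
      rintro rfl
      simp at hn
    obtain ⟨s, hs : cs.length (cs.simple s * w) < cs.length w⟩ :=
      cs.exists_leftDescent_of_ne_one hw1
    have hlen : cs.length (cs.simple s * w) = n := by
      have := cs.length_simple_mul w s
      lia
    rcases (cs.length_simple_mul_ne u s).lt_or_gt with hsu | hsu
    · refine BruhatLE.of_simple_mul (ih (hu.simple_mul_of_lt hsu) (fun i hi ↦ ?_) hlen) hs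
      obtain ⟨x, y, hx, hy, hxu, hyw, hxy⟩ := h i hi
      obtain ⟨y', hy', hyw', -, H⟩ := hx.exists_projection_le hy hxu hyw hxy hs
      obtain ⟨x', hx', hxu', hxy'⟩ := H hsu
      exact ⟨x', y', hx', hy', hxu', hyw', hxy'⟩
    · refine (ih hu (fun i hi ↦ ?_) hlen).trans (.of_simple_mul_lt hs)
      obtain ⟨x, y, hx, hy, hxu, hyw, hxy⟩ := h i hi
      obtain ⟨y', hy', hyw', H, -⟩ := hx.exists_projection_le hy hxu hyw hxy hs
      exact ⟨x, y', hx, hy', hxu, hyw', H hsu⟩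

end IsMinRep

/-- Let `W` be the Weyl group of a simple complex Lie group `G` (a Coxeter group),
`Δ_P = S` the set of simple roots of a parabolic `P`, so that `Δ \ Δ_P = Sᶜ`.  For
`u, w ∈ W^P` let `u_i, w_i ∈ W^{P_i}` (where `Δ_{P_i} = Δ \ {i}`) be the minimal length
representatives of `u W_{P_i}`, `w W_{P_i}`.  Then `u ≤ w` in Bruhat order iff
`u_i ≤ w_i` for every `i ∈ Δ \ Δ_P`. -/
theorem stmt_11 {M : CoxeterMatrix B} (cs : CoxeterSystem M W) (S : Set B)
    (u w : W) (hu : IsMinRep cs S u) (hw : IsMinRep cs S w)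
    (ui wi : B → W)
    (hui : ∀ i ∉ S, IsMinRep cs ({i}ᶜ) (ui i) ∧ (ui i)⁻¹ * u ∈ parabolicSubgroup cs ({i}ᶜ))
    (hwi : ∀ i ∉ S, IsMinRep cs ({i}ᶜ) (wi i) ∧ (wi i)⁻¹ * w ∈ parabolicSubgroup cs ({i}ᶜ)) :
    BruhatLE cs u w ↔ ∀ i ∉ S, BruhatLE cs (ui i) (wi i) := by
  refine ⟨fun h i hi ↦ (hui i hi).1.le_of_le (hui i hi).2 (hwi i hi).2 h, fun h ↦ ?_⟩
  exact hu.le_of_forall_projection_le fun i hi ↦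
    ⟨ui i, wi i, (hui i hi).1, (hwi i hi).1, (hui i hi).2, (hwi i hi).2, h i hi⟩
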